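/- arXiv:1804.03169 — 7 statements merged into one kernel-verified Lean document; each statement's English description precedes it below -/
import Mathlib

section
/- Let α ∈ (0,1] and let f, g be α-differentiable at a point t > 0. Then the product f·g is α-differentiable at t and D^α(f·g)(t) = f(t)·D^α g(t) + g(t)·D^α f(t). -/
open Filter Set MeasureTheory

/-- `f` is α-differentiable at `t` with conformable fractional derivative `L`:
`D^α f(t) = lim_{ε→0} (f(t + ε t^{1-α}) - f t)/ε = L`. -/
def HasConfDerivAt (α : ℝ) (f : ℝ → ℝ) (L t : ℝ) : Prop :=
  Filter.Tendsto (fun ε : ℝ => (f (t + ε * t ^ (1 - α)) - f t) / ε)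
    (nhdsWithin 0 {(0 : ℝ)}ᶜ) (nhds L)

/-- The conformable fractional derivative operator `D^α` (junk value if the limit
does not exist). -/
noncomputable def confDeriv (α : ℝ) (f : ℝ → ℝ) (t : ℝ) : ℝ :=
  limUnder (nhdsWithin 0 {(0 : ℝ)}ᶜ)
    (fun ε : ℝ => (f (t + ε * t ^ (1 - α)) - f t) / ε)

theorem conformable_deriv_mul (α t : ℝ) (hα : 0 < α ∧ α ≤ 1) (ht : 0 < t)
    (f g : ℝ → ℝ) (Lf Lg : ℝ)
    (hf : HasConfDerivAt α f Lf t) (hg : HasConfDerivAt α g Lg t) :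
    HasConfDerivAt α (fun s => f s * g s) (f t * Lg + g t * Lf) t := by
  have hε : Tendsto (fun ε : ℝ => ε) (nhdsWithin 0 {(0 : ℝ)}ᶜ) (nhds 0) :=
    tendsto_id.mono_left nhdsWithin_le_nhds
  have h := ((hg.const_mul (f t)).add (hf.const_mul (g t))).add ((hε.mul hf).mul hg)
  simp only [zero_mul, add_zero] at h
  refine h.congr' ?_
  filter_upwards [self_mem_nhdsWithin] with ε hne
  have hne' : ε ≠ 0 := hne
  field_simp
  ring
end

section
/- Let α ∈ (0,1] and t > 0. If f is differentiable at t (in the classical sense), then f is α-differentiable at t and D^α f(t) = t^{1−α}·f'(t), where f' denotes the classical derivative. -/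
open Filter Set MeasureTheory

theorem conformable_deriv_of_hasDerivAt (α t : ℝ) (hα : 0 < α ∧ α ≤ 1) (ht : 0 < t)
    (f : ℝ → ℝ) (f' : ℝ) (hf : HasDerivAt f f' t) :
    HasConfDerivAt α f (t ^ (1 - α) * f') t := by
  have hline : HasDerivAt (fun ε : ℝ => t + ε * t ^ (1 - α)) (t ^ (1 - α)) 0 := by
    simpa using ((hasDerivAt_id (0 : ℝ)).mul_const (t ^ (1 - α))).const_add t
  have hcomp : HasDerivAt (fun ε : ℝ => f (t + ε * t ^ (1 - α))) (f' * t ^ (1 - α)) 0 :=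
    HasDerivAt.comp (0 : ℝ) (by simpa using hf) hline
  rw [mul_comm]
  simpa [HasConfDerivAt, div_eq_inv_mul] using hcomp.tendsto_slope_zero
end

section
/- Let α ∈ (0,1] and let f : [0,∞) → ℝ be continuous. Then for every t > 0, the function I^α f is α-differentiable at t and D^α(I^α f)(t) = f(t). -/
open Filter Set MeasureTheory

theorem HasDerivAt.hasConfDerivAt {α L t : ℝ} {F : ℝ → ℝ} (hF : HasDerivAt F L t) :
    HasConfDerivAt α F (L * t ^ (1 - α)) t := by
  have hline : HasDerivAt (fun ε : ℝ => t + ε * t ^ (1 - α)) (t ^ (1 - α)) 0 := by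
    simpa using ((hasDerivAt_id (0 : ℝ)).mul_const (t ^ (1 - α))).const_add t
  have hcomp : HasDerivAt (fun ε : ℝ => F (t + ε * t ^ (1 - α))) (L * t ^ (1 - α)) 0 :=
    HasDerivAt.comp (0 : ℝ) (by simpa using hF) hline
  refine (hasDerivAt_iff_tendsto_slope_zero.mp hcomp).congr fun ε => ?_
  simp [div_eq_inv_mul]

theorem hasDerivAt_integral_mul_rpow {α t : ℝ} (hα : 0 < α) {f : ℝ → ℝ}
    (hf : ContinuousOn f (Set.Ici 0)) (ht : 0 < t) :
    HasDerivAt (fun s : ℝ => ∫ τ in (0 : ℝ)..s, f τ * τ ^ (α - 1)) (f t * t ^ (α - 1)) t := by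
  have hcont : ContinuousOn (fun τ : ℝ => f τ * τ ^ (α - 1)) (Set.Ioi 0) :=
    (hf.mono Set.Ioi_subset_Ici_self).mul
      (continuousOn_id.rpow_const fun x hx => Or.inl (ne_of_gt hx))
  refine intervalIntegral.integral_hasDerivAt_right ?_
    (hcont.stronglyMeasurableAtFilter isOpen_Ioi t ht) (hcont.continuousAt (Ioi_mem_nhds ht))
  refine (intervalIntegral.intervalIntegrable_rpow' (by linarith)).continuousOn_mul (hf.mono ?_)
  rw [Set.uIcc_of_le ht.le]
  exact Set.Icc_subset_Ici_self

theorem conformable_deriv_conformable_integral (α : ℝ) (hα : 0 < α ∧ α ≤ 1)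
    (f : ℝ → ℝ) (hf : ContinuousOn f (Set.Ici 0)) :
    ∀ t > (0 : ℝ),
      HasConfDerivAt α (fun s : ℝ => ∫ τ in (0 : ℝ)..s, f τ * τ ^ (α - 1)) (f t) t := by
  intro t ht
  have h := (hasDerivAt_integral_mul_rpow hα.1 hf ht).hasConfDerivAt (α := α)
  have hpow : f t * t ^ (α - 1) * t ^ (1 - α) = f t := by
    rw [mul_assoc, ← Real.rpow_add ht]
    simp
  rwa [hpow] at h
end

section
/- Let α ∈ (0,1] and t > 0. Suppose g is α-differentiable at t with g(t) > 0, and f is α-differentiable at g(t). Then the composition f∘g is α-differentiable at t and D^α(f∘g)(t) = D^α f(g(t)) · D^α g(t) · g(t)^{α−1}. -/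
open Filter Set MeasureTheory

/-- At a point `t > 0`, having conformable derivative `L` means having classical derivative
`L * t ^ (α - 1)`. -/
theorem hasConfDerivAt_iff_hasDerivAt {α t : ℝ} (ht : 0 < t) (f : ℝ → ℝ) (L : ℝ) :
    HasConfDerivAt α f L t ↔ HasDerivAt f (L * t ^ (α - 1)) t := by
  have hc : t ^ (1 - α) ≠ 0 := (Real.rpow_pos_of_pos ht _).ne'
  have hinv : t ^ (α - 1) = (t ^ (1 - α))⁻¹ := by
    rw [← Real.rpow_neg ht.le, neg_sub]
  have key : HasConfDerivAt α f L t ↔ HasDerivAt (fun ε => f (t + ε * t ^ (1 - α))) L 0 := by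
    rw [hasDerivAt_iff_tendsto_slope_zero]
    simp [HasConfDerivAt, div_eq_inv_mul]
  rw [key, hinv]
  generalize t ^ (1 - α) = c at hc
  constructor
  · intro h
    have hk : HasDerivAt (fun x : ℝ => (x - t) * c⁻¹) c⁻¹ t := by
      simpa using ((hasDerivAt_id t).sub_const t).mul_const c⁻¹
    have h' := HasDerivAt.comp_of_eq t h hk (by simp)
    refine h'.congr_of_eventuallyEq (Eventually.of_forall fun x => ?_)
    simp [hc]
  · intro h
    have hk : HasDerivAt (fun ε : ℝ => t + ε * c) c 0 := by
      simpa using ((hasDerivAt_id (0 : ℝ)).mul_const c).const_add t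
    have h' := HasDerivAt.comp_of_eq 0 h hk (by simp)
    rwa [inv_mul_cancel_right₀ hc] at h'

theorem conformable_chain_rule (α t : ℝ) (hα : 0 < α ∧ α ≤ 1) (ht : 0 < t)
    (f g : ℝ → ℝ) (Lf Lg : ℝ)
    (hg : HasConfDerivAt α g Lg t) (hgt : 0 < g t)
    (hf : HasConfDerivAt α f Lf (g t)) :
    HasConfDerivAt α (f ∘ g) (Lf * Lg * (g t) ^ (α - 1)) t := by
  rw [hasConfDerivAt_iff_hasDerivAt ht] at hg ⊢
  rw [hasConfDerivAt_iff_hasDerivAt hgt] at hf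
  exact (hf.comp t hg).congr_deriv (by ring)
end

section
/- Let α ∈ (0,1] and t > 0. Suppose g is α-differentiable at t and f is differentiable (in the classical sense) at g(t). Then the composition f∘g is α-differentiable at t and D^α(f∘g)(t) = f'(g(t)) · D^α g(t), where f' denotes the classical derivative of f. -/
open Filter Set MeasureTheory

theorem conformable_chain_rule' (α t : ℝ) (hα : 0 < α ∧ α ≤ 1) (ht : 0 < t)
    (f g : ℝ → ℝ) (f' Lg : ℝ)
    (hg : HasConfDerivAt α g Lg t) (hf : HasDerivAt f f' (g t)) :
    HasConfDerivAt α (f ∘ g) (f' * Lg) t := by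
  have key : ∀ (u : ℝ → ℝ) (L : ℝ),
      HasConfDerivAt α u L t ↔ HasDerivAt (fun ε : ℝ => u (t + ε * t ^ (1 - α))) L 0 := by
    intro u L
    simp only [HasConfDerivAt, hasDerivAt_iff_tendsto_slope_zero, zero_add, zero_mul, add_zero,
      smul_eq_mul, div_eq_inv_mul]
  rw [key] at hg ⊢
  exact HasDerivAt.comp (h₂ := f) 0 (by simpa using hf) hg
end

section
/- Let 0 < α, β ≤ 1 and let Ψ : (0,∞) → ℝ be three times continuously differentiable. If Ψ satisfies the reduced equation D^{3α}Ψ(ζ) + 6·Ψ(ζ)·D^αΨ(ζ) − (β/3)·(ζ^α/α)·D^αΨ(ζ) − (2β/3)·Ψ(ζ) = 0 for all ζ > 0, then the function u(t,x) = t^{−2β/3}·Ψ(x·t^{−β/(3α)}) satisfies the time–space conformable fractional KdV equation ∂^β u/∂t^β + 6u·∂^α u/∂x^α + ∂^{3α} u/∂x^{3α} = 0 for all t, x > 0. -/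
open Filter Set MeasureTheory

theorem confDeriv_eq_of_hasDerivAt {α : ℝ} {f : ℝ → ℝ} {f' t : ℝ}
    (hf : HasDerivAt f f' t) : confDeriv α f t = t ^ (1 - α) * f' := by
  have hline : HasDerivAt (fun ε : ℝ => t + ε * t ^ (1 - α)) (t ^ (1 - α)) 0 := by
    simpa using ((hasDerivAt_id (0 : ℝ)).mul_const (t ^ (1 - α))).const_add t
  have hcomp : HasDerivAt (fun ε : ℝ => f (t + ε * t ^ (1 - α))) (f' * t ^ (1 - α)) 0 :=
    HasDerivAt.comp (h₂ := f) 0 (by simpa using hf) hline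
  have hlim := hcomp.tendsto_slope_zero
  refine Filter.Tendsto.limUnder_eq ?_
  rw [mul_comm]
  simpa [div_eq_inv_mul] using hlim

theorem confDeriv_eq_rpow_mul_deriv {α : ℝ} {f : ℝ → ℝ} {t : ℝ}
    (hf : DifferentiableAt ℝ f t) : confDeriv α f t = t ^ (1 - α) * deriv f t :=
  confDeriv_eq_of_hasDerivAt hf.hasDerivAt

theorem ContDiffOn.differentiableAt_of_pos {f : ℝ → ℝ} {n : ℕ}
    (hf : ContDiffOn ℝ (n + 1) f (Ioi 0)) {t : ℝ} (ht : 0 < t) : DifferentiableAt ℝ f t :=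
  (hf.differentiableOn (by simp)).differentiableAt (Ioi_mem_nhds ht)

theorem contDiffOn_confDeriv {α : ℝ} {f : ℝ → ℝ} {n : ℕ}
    (hf : ContDiffOn ℝ (n + 1) f (Ioi 0)) : ContDiffOn ℝ n (confDeriv α f) (Ioi 0) := by
  have hd : ContDiffOn ℝ n (deriv f) (Ioi 0) := hf.deriv_of_isOpen isOpen_Ioi le_rfl
  have hp : ContDiffOn ℝ n (fun t : ℝ => t ^ (1 - α)) (Ioi 0) :=
    contDiffOn_id.rpow_const_of_ne fun t ht => ht.ne'
  exact (hp.mul hd).congr fun t ht =>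
    confDeriv_eq_rpow_mul_deriv (hf.differentiableAt_of_pos ht)

theorem confDeriv_const_mul_comp_mul {α A c : ℝ} (hc : 0 < c) {f g : ℝ → ℝ} {n : ℕ}
    (hf : ContDiffOn ℝ (n + 1) f (Ioi 0)) (hg : ∀ x > 0, g x = A * f (x * c))
    {x : ℝ} (hx : 0 < x) : confDeriv α g x = A * c ^ α * confDeriv α f (x * c) := by
  have hxc : 0 < x * c := mul_pos hx hc
  have hfd := hf.differentiableAt_of_pos hxc
  have hgd : HasDerivAt g (A * (deriv f (x * c) * c)) x := by
    refine HasDerivAt.congr_of_eventuallyEq (f := fun y => A * f (y * c)) ?_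
      (Filter.eventually_of_mem (Ioi_mem_nhds hx) hg)
    exact (HasDerivAt.comp (h₂ := f) x hfd.hasDerivAt (hasDerivAt_mul_const c)).const_mul A
  rw [confDeriv_eq_of_hasDerivAt hgd, confDeriv_eq_rpow_mul_deriv hfd,
    Real.mul_rpow hx.le hc.le]
  have hpow : c ^ α * c ^ (1 - α) = c := by
    rw [← Real.rpow_add hc, add_sub_cancel, Real.rpow_one]
  linear_combination (-A * x ^ (1 - α) * deriv f (x * c)) * hpow

theorem kdv_similarity_reduction (α β : ℝ) (hα : 0 < α ∧ α ≤ 1) (hβ : 0 < β ∧ β ≤ 1)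
    (Ψ : ℝ → ℝ) (hΨ : ContDiffOn ℝ 3 Ψ (Set.Ioi 0))
    (hred : ∀ ζ > (0 : ℝ),
      confDeriv α (confDeriv α (confDeriv α Ψ)) ζ
        + 6 * Ψ ζ * confDeriv α Ψ ζ
        - (β / 3) * (ζ ^ α / α) * confDeriv α Ψ ζ
        - (2 * β / 3) * Ψ ζ = 0)
    (u : ℝ → ℝ → ℝ)
    (hu : ∀ t x : ℝ, u t x = t ^ (-(2 * β) / 3) * Ψ (x * t ^ (-β / (3 * α)))) :
    ∀ t > (0 : ℝ), ∀ x > (0 : ℝ),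
      confDeriv β (fun s => u s x) t
        + 6 * u t x * confDeriv α (u t) x
        + confDeriv α (confDeriv α (confDeriv α (u t))) x = 0 := by
  intro t ht x hx
  have hα0 : α ≠ 0 := hα.1.ne'
  have hΨ3 : ContDiffOn ℝ ((2 : ℕ) + 1) Ψ (Ioi 0) := by
    convert hΨ using 1
    norm_num
  have hΨ2 : ContDiffOn ℝ ((1 : ℕ) + 1) (confDeriv α Ψ) (Ioi 0) := by
    convert contDiffOn_confDeriv (α := α) hΨ3 using 1
    norm_num
  have hΨ1 : ContDiffOn ℝ ((0 : ℕ) + 1) (confDeriv α (confDeriv α Ψ)) (Ioi 0) := by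
    convert contDiffOn_confDeriv (α := α) hΨ2 using 1
    norm_num
  have hc : 0 < t ^ (-β / (3 * α)) := Real.rpow_pos_of_pos ht _
  have hu1 : ∀ y > 0, confDeriv α (u t) y = _ := fun y hy =>
    confDeriv_const_mul_comp_mul hc hΨ3 (fun z _ => hu t z) hy
  have hu2 : ∀ y > 0, confDeriv α (confDeriv α (u t)) y = _ := fun y hy =>
    confDeriv_const_mul_comp_mul hc hΨ2 hu1 hy
  have hu3 := confDeriv_const_mul_comp_mul (α := α) hc hΨ1 hu2 hx
  have hζ : 0 < x * t ^ (-β / (3 * α)) := mul_pos hx hc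
  have hΨd := hΨ3.differentiableAt_of_pos hζ
  have hut := (Real.hasDerivAt_rpow_const (p := -(2 * β) / 3) (Or.inl ht.ne')).mul
    (HasDerivAt.comp (h₂ := Ψ) t hΨd.hasDerivAt
      ((Real.hasDerivAt_rpow_const (p := -β / (3 * α)) (Or.inl ht.ne')).const_mul x))
  have hus : (fun s => u s x) =
      (fun s : ℝ => s ^ (-(2 * β) / 3)) * (Ψ ∘ fun s : ℝ => x * s ^ (-β / (3 * α))) :=
    funext fun s => hu s x
  rw [← hus] at hut
  rw [confDeriv_eq_of_hasDerivAt hut, hu3, hu1 x hx, hu t x]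
  have hscale : (t ^ (-β / (3 * α))) ^ α = t ^ (-β / 3) := by
    rw [← Real.rpow_mul ht.le]
    congr 1
    field_simp
  have hA : t ^ (-(2 * β) / 3) = (t ^ (-β / 3)) ^ 2 := by
    rw [← Real.rpow_mul_natCast ht.le]
    congr 1
    push_cast
    ring
  have htβ : t ^ (1 - β) = t * (t ^ (-β / 3)) ^ 3 := by
    rw [← Real.rpow_mul_natCast ht.le, sub_eq_add_neg, Real.rpow_add ht, Real.rpow_one]
    congr 2
    push_cast
    ring
  have hred' := hred _ hζ
  have hζD : (x * t ^ (-β / (3 * α))) ^ α * confDeriv α Ψ (x * t ^ (-β / (3 * α))) =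
      x * t ^ (-β / (3 * α)) * deriv Ψ (x * t ^ (-β / (3 * α))) := by
    rw [confDeriv_eq_rpow_mul_deriv hΨd, ← mul_assoc, ← Real.rpow_add hζ,
      add_sub_cancel, Real.rpow_one]
  simp only [Function.comp_apply]
  rw [Real.rpow_sub_one ht.ne', Real.rpow_sub_one ht.ne', hscale, htβ, hA]
  generalize t ^ (-β / 3) = b at *
  generalize t ^ (-β / (3 * α)) = c at *
  have ht0 := ht.ne'
  field_simp at hred' ⊢
  linear_combination b ^ 5 * hred' + b ^ 5 * β * hζD
end

section
/- Let α ∈ (0,1], γ ∈ ℝ, and let W be three times continuously differentiable on a neighborhood of a point ω > 0, with 2W(ω') ≠ (ω')^α/α for all ω' in that neighborhood. Define K₁(W)(ω) = D^{3α}W(ω) + 6W(ω)·D^αW(ω) − (ω^α/α)·D^αW(ω) − 2W(ω) and K₂(W)(ω) = D^{2α}W(ω) + 2W(ω)² − (ω^α/α)·W(ω) + [γ(γ+1) + D^αW(ω) − (D^αW(ω))²]/(2W(ω) − ω^α/α). Then D^α[(2W − ω^α/α)·K₂(W)](ω) = (2W(ω) − ω^α/α)·K₁(W)(ω). -/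
open Filter Set MeasureTheory

/-- The conformable derivative of a differentiable function is `t ^ (1 - α)`
times the ordinary derivative. -/
theorem HasDerivAt.confDeriv_eq {α t f' : ℝ} {f : ℝ → ℝ} (hf : HasDerivAt f f' t) :
    confDeriv α f t = t ^ (1 - α) * f' := by
  have hc : HasDerivAt (fun ε : ℝ => f (t + ε * t ^ (1 - α))) (t ^ (1 - α) * f') 0 := by
    have hg : HasDerivAt (fun ε : ℝ => t + ε * t ^ (1 - α)) (t ^ (1 - α)) 0 := by
      simpa using ((hasDerivAt_id (0 : ℝ)).mul_const (t ^ (1 - α))).const_add t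
    have hf0 : HasDerivAt f f' (t + 0 * t ^ (1 - α)) := by simpa using hf
    simpa [mul_comm, Function.comp_def] using hf0.comp (0 : ℝ) hg
  refine Filter.Tendsto.limUnder_eq ?_
  refine (hasDerivAt_iff_tendsto_slope.mp hc).congr fun ε => ?_
  simp [slope_def_field]

theorem ContDiffAt.contDiffAt_confDeriv {α t : ℝ} {f : ℝ → ℝ} {n : ℕ}
    (hf : ContDiffAt ℝ (n + 1) f t)
    (ht : 0 < t) : ContDiffAt ℝ n (confDeriv α f) t := by
  have h : confDeriv α f =ᶠ[nhds t] fun x => x ^ (1 - α) * deriv f x := by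
    filter_upwards [hf.eventually (by norm_cast; simp)] with x hx
    exact (hx.differentiableAt (by norm_cast)).hasDerivAt.confDeriv_eq
  refine ContDiffAt.congr_of_eventuallyEq ?_ h
  exact (Real.contDiffAt_rpow_const_of_ne ht.ne').mul (hf.fderiv_right_succ.clm_apply contDiffAt_const)

/-- At a positive point a differentiable `f` has ordinary derivative
`t ^ (α - 1) * D^α f(t)`. -/
theorem DifferentiableAt.hasDerivAt_confDeriv (α : ℝ) {t : ℝ} {f : ℝ → ℝ}
    (hf : DifferentiableAt ℝ f t) (ht : 0 < t) :
    HasDerivAt f (t ^ (α - 1) * confDeriv α f t) t := by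
  rw [hf.hasDerivAt.confDeriv_eq, ← mul_assoc, ← Real.rpow_add ht]
  simpa using hf.hasDerivAt

theorem kdv_first_integral_identity (α γ ω : ℝ) (hα : 0 < α ∧ α ≤ 1) (hω : 0 < ω)
    (W : ℝ → ℝ) (s : Set ℝ) (hs : s ∈ nhds ω) (hW : ContDiffOn ℝ 3 W s)
    (hne : ∀ ω' ∈ s, 2 * W ω' ≠ ω' ^ α / α) :
    confDeriv α
      (fun ω' => (2 * W ω' - ω' ^ α / α) *
        (confDeriv α (confDeriv α W) ω' + 2 * (W ω') ^ 2 - (ω' ^ α / α) * W ω'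
          + (γ * (γ + 1) + confDeriv α W ω' - (confDeriv α W ω') ^ 2)
              / (2 * W ω' - ω' ^ α / α))) ω
      = (2 * W ω - ω ^ α / α) *
        (confDeriv α (confDeriv α (confDeriv α W)) ω + 6 * W ω * confDeriv α W ω
          - (ω ^ α / α) * confDeriv α W ω - 2 * W ω) := by
  obtain ⟨hα0, -⟩ := hα
  have hW3 : ContDiffAt ℝ ((2 : ℕ) + 1) W ω := by
    have := hW.contDiffAt hs
    norm_num
    exact this
  have hW2 : ContDiffAt ℝ ((1 : ℕ) + 1) (confDeriv α W) ω := by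
    have := hW3.contDiffAt_confDeriv (α := α) hω
    norm_num at this ⊢
    exact this
  have hW1 : ContDiffAt ℝ 1 (confDeriv α (confDeriv α W)) ω := by
    exact_mod_cast hW2.contDiffAt_confDeriv (α := α) hω
  have d0 := (hW3.differentiableAt (by norm_num)).hasDerivAt_confDeriv α hω
  have d1 := (hW2.differentiableAt (by norm_num)).hasDerivAt_confDeriv α hω
  have d2 := (hW1.differentiableAt (by norm_num)).hasDerivAt_confDeriv α hω
  have dz : HasDerivAt (fun x : ℝ => x ^ α / α) (ω ^ (α - 1)) ω := by
    simpa [mul_div_cancel_left₀ _ hα0.ne'] using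
      (Real.hasDerivAt_rpow_const (p := α) (Or.inl hω.ne')).div_const α
  have hd := (((((d0.const_mul 2).sub dz).mul ((d2.add ((d0.pow 2).const_mul 2)).sub (dz.mul d0))).add
    (d1.const_add (γ * (γ + 1)))).sub (d1.pow 2))
  have heq := HasDerivAt.congr_of_eventuallyEq hd (f₁ := fun ω' => (2 * W ω' - ω' ^ α / α) *
        (confDeriv α (confDeriv α W) ω' + 2 * (W ω') ^ 2 - (ω' ^ α / α) * W ω'
          + (γ * (γ + 1) + confDeriv α W ω' - (confDeriv α W ω') ^ 2)
              / (2 * W ω' - ω' ^ α / α))) (by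
    filter_upwards [hs] with x hx
    have hx0 : 2 * W x - x ^ α / α ≠ 0 := sub_ne_zero.mpr (hne x hx)
    rw [mul_add, mul_div_cancel₀ _ hx0]
    simp only [Pi.add_apply, Pi.sub_apply, Pi.mul_apply, Pi.pow_apply]
    ring)
  rw [heq.confDeriv_eq]
  have hcancel : ω ^ (1 - α) * ω ^ (α - 1) = 1 := by
    rw [← Real.rpow_add hω]
    simp
  simp only [Pi.add_apply, Pi.sub_apply, Pi.mul_apply, Pi.pow_apply]
  generalize ω ^ α / α = z
  linear_combination (2 * W ω - z) * (confDeriv α (confDeriv α (confDeriv α W)) ω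
    + 6 * W ω * confDeriv α W ω - z * confDeriv α W ω - 2 * W ω) * hcancel
end
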